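/- Let R be an associative unital algebra over a commutative ring K, q, γ ∈ K, and x, y ∈ R with yx = q·xy + γ·1. Then for all natural numbers m, n: y^m · x^n = Σ_{k=0}^{min(m,n)} qbinom(m,k) · ([n]_q · [n-1]_q ⋯ [n-k+1]_q) · q^{(n-k)(m-k)} · γ^k · x^{n-k} · y^{m-k}, where qbinom is the Gaussian binomial coefficient and [j]_q = 1 + q + ... + q^{j-1}. -/

import Mathlib

/-- The q-integer `[n]_q = 1 + q + ⋯ + q^(n-1)`. -/
def qint {K : Type*} [CommRing K] (q : K) (n : ℕ) : K := ∑ i ∈ Finset.range n, q ^ i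

/-- Gaussian (q-)binomial coefficient, via the q-Pascal recurrence. -/
def qbinom {K : Type*} [CommRing K] (q : K) : ℕ → ℕ → K
  | _, 0 => 1
  | 0, _ + 1 => 0
  | n + 1, k + 1 => qbinom q n k + q ^ (k + 1) * qbinom q n (k + 1)

theorem qbinom_zero_right {K : Type*} [CommRing K] (q : K) (n : ℕ) : qbinom q n 0 = 1 := by
  cases n <;> rfl

theorem qbinom_eq_zero_of_lt {K : Type*} [CommRing K] (q : K) {n k : ℕ} (hnk : n < k) :
    qbinom q n k = 0 := by
  induction n generalizing k with
  | zero =>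
    obtain ⟨k, rfl⟩ := Nat.exists_eq_succ_of_ne_zero hnk.ne'
    rfl
  | succ n ih =>
    obtain ⟨k, rfl⟩ := Nat.exists_eq_succ_of_ne_zero (Nat.ne_zero_of_lt hnk)
    simp only [qbinom]
    rw [ih (by omega), ih (by omega)]
    simp

theorem prod_qint_eq_zero_of_lt {K : Type*} [CommRing K] (q : K) {n k : ℕ} (hnk : n < k) :
    ∏ i ∈ Finset.range k, qint q (n - i) = 0 :=
  Finset.prod_eq_zero (Finset.mem_range.mpr hnk) (by simp [qint])

theorem prod_qint_succ {K : Type*} [CommRing K] (q : K) (n k : ℕ) :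
    ∏ i ∈ Finset.range (k + 1), qint q (n + 1 - i) =
      qint q (n + 1) * ∏ i ∈ Finset.range k, qint q (n - i) := by
  rw [Finset.prod_range_succ', mul_comm]
  simp

/-- The `k`-th summand in the normal ordering of `y ^ m * x ^ n`. -/
def qWeylTerm {K : Type*} [CommRing K] {R : Type*} [Ring R] [Algebra K R]
    (q γ : K) (x y : R) (m n k : ℕ) : R :=
  (qbinom q m k * (∏ i ∈ Finset.range k, qint q (n - i)) *
      q ^ ((n - k) * (m - k)) * γ ^ k) •
    (x ^ (n - k) * y ^ (m - k))

section

variable {K : Type*} [CommRing K] {R : Type*} [Ring R] [Algebra K R] (q γ : K) (x y : R)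

theorem qWeylTerm_eq_zero_of_lt_left {m k : ℕ} (n : ℕ) (hk : m < k) :
    qWeylTerm q γ x y m n k = 0 := by
  simp [qWeylTerm, qbinom_eq_zero_of_lt q hk]

theorem qWeylTerm_eq_zero_of_lt_right (m : ℕ) {n k : ℕ} (hk : n < k) :
    qWeylTerm q γ x y m n k = 0 := by
  simp [qWeylTerm, prod_qint_eq_zero_of_lt q hk]

theorem qWeylTerm_zero (m n : ℕ) :
    qWeylTerm q γ x y m n 0 = q ^ (n * m) • (x ^ n * y ^ m) := by
  simp [qWeylTerm, qbinom_zero_right]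

theorem qWeylTerm_succ {m k : ℕ} (n : ℕ) (hk : k ≤ m) :
    qWeylTerm q γ x y (m + 1) (n + 1) (k + 1) =
      q ^ (n + 1) • (qWeylTerm q γ x y m (n + 1) (k + 1) * y) +
        (qint q (n + 1) * γ) • qWeylTerm q γ x y m n k := by
  rcases lt_or_ge n k with hn | hn
  · simp [qWeylTerm_eq_zero_of_lt_right, hn]
  obtain ⟨b, rfl⟩ := Nat.exists_eq_add_of_le hn
  rcases hk.eq_or_lt with rfl | hk
  · rw [qWeylTerm_eq_zero_of_lt_left q γ x y _ (Nat.lt_succ_self k)]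
    simp only [qWeylTerm, prod_qint_succ, qbinom, qbinom_eq_zero_of_lt q (Nat.lt_succ_self k),
      Nat.add_sub_add_right, zero_mul, smul_zero, zero_add, smul_smul]
    congr 1
    ring
  · obtain ⟨a, rfl⟩ := Nat.exists_eq_add_of_lt hk
    have ha : k + a + 1 - (k + 1) = a := by omega
    have ha' : k + a + 1 - k = a + 1 := by omega
    simp only [qWeylTerm, prod_qint_succ, qbinom, Nat.add_sub_add_right, Nat.add_sub_cancel_left,
      ha, ha', smul_mul_assoc, mul_assoc (x ^ b), ← pow_succ, smul_smul, ← add_smul]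
    congr 1
    ring

variable {q γ x y}

theorem q_weyl_mul_pow (h : y * x = q • (x * y) + γ • (1 : R)) (n : ℕ) :
    y * x ^ (n + 1) = q ^ (n + 1) • (x ^ (n + 1) * y) + (qint q (n + 1) * γ) • x ^ n := by
  induction n with
  | zero => simp [qint, h]
  | succ n ih =>
    have hq : qint q (n + 1 + 1) = qint q (n + 1) + q ^ (n + 1) := Finset.sum_range_succ _ _
    rw [pow_succ x (n + 1), ← mul_assoc, ih, add_mul, smul_mul_assoc, mul_assoc, h, hq,
      smul_mul_assoc, ← pow_succ, mul_add, mul_smul_comm, mul_smul_comm, mul_one, ← mul_assoc,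
      ← pow_succ]
    module

theorem q_weyl_pow_mul_pow (h : y * x = q • (x * y) + γ • (1 : R)) (m n : ℕ) :
    y ^ m * x ^ n = ∑ k ∈ Finset.range (m + 1), qWeylTerm q γ x y m n k := by
  induction m generalizing n with
  | zero => simp [qWeylTerm_zero]
  | succ m ih =>
    cases n with
    | zero =>
      rw [Finset.sum_range_succ', Finset.sum_eq_zero, qWeylTerm_zero]
      · simp
      · exact fun k _ => qWeylTerm_eq_zero_of_lt_right q γ x y _ k.succ_pos
    | succ n =>
      have hsum : y ^ m * x ^ (n + 1) =
          ∑ k ∈ Finset.range (m + 1), qWeylTerm q γ x y m (n + 1) (k + 1) +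
            qWeylTerm q γ x y m (n + 1) 0 := by
        rw [ih, ← Finset.sum_range_succ', Finset.sum_range_succ _ (m + 1),
          qWeylTerm_eq_zero_of_lt_left q γ x y _ m.lt_succ_self, add_zero]
      have hzero : qWeylTerm q γ x y (m + 1) (n + 1) 0 =
          q ^ (n + 1) • (qWeylTerm q γ x y m (n + 1) 0 * y) := by
        rw [qWeylTerm_zero, qWeylTerm_zero, smul_mul_assoc, mul_assoc, ← pow_succ, smul_smul]
        congr 1
        ring
      rw [Finset.sum_range_succ', Finset.sum_congr rfl fun k hk =>
        qWeylTerm_succ q γ x y n (Nat.lt_succ_iff.mp (Finset.mem_range.mp hk)),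
        Finset.sum_add_distrib, ← Finset.smul_sum, ← Finset.smul_sum, ← Finset.sum_mul, ← ih n,
        hzero, add_right_comm, ← smul_add, ← add_mul, ← hsum, pow_succ, mul_assoc,
        q_weyl_mul_pow h, mul_add, mul_smul_comm, mul_smul_comm, mul_assoc]

end

theorem q_weyl_mul_formula {K : Type*} [CommRing K] {R : Type*} [Ring R] [Algebra K R]
    (q γ : K) (x y : R) (h : y * x = q • (x * y) + γ • (1 : R)) (m n : ℕ) :
    y ^ m * x ^ n =
      ∑ k ∈ Finset.range (min m n + 1),
        (qbinom q m k * (∏ i ∈ Finset.range k, qint q (n - i)) *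
            q ^ ((n - k) * (m - k)) * γ ^ k) •
          (x ^ (n - k) * y ^ (m - k)) := by
  rw [q_weyl_pow_mul_pow h]
  symm
  refine Finset.sum_subset (Finset.range_mono (by omega)) fun k hk hk' => ?_
  simp only [Finset.mem_range] at hk hk'
  exact qWeylTerm_eq_zero_of_lt_right q γ x y m (by omega)
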